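/- (Proposition 7.3 of the paper.) Let k be a field, V a k-vector space of finite dimension r ≥ 2, and (F^x_•, F^y_•, l) a generic triple in V. Then for every linear subspace W ⊆ V with 0 < dim W < r one has μ(W) < μ(V), i.e. the strict inequality deg(W)/dim(W) < r − 1/r holds. -/

import Mathlib

/-- A full flag in an `r`-dimensional vector space `V`:
a chain `V = F 1 ⊃ F 2 ⊃ ⋯ ⊃ F r ⊃ F (r+1) = 0` with `dim (F i) = r - i + 1`. -/
def IsFullFlag (k : Type*) [Field k] (V : Type*) [AddCommGroup V] [Module k V]
    (r : ℕ) (F : ℕ → Submodule k V) : Prop :=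
  (∀ i, 1 ≤ i → i ≤ r → F (i + 1) ≤ F i) ∧
  (∀ i, 1 ≤ i → i ≤ r + 1 → Module.finrank k (F i) = r + 1 - i)

/-- A pair of full flags is generic if
`dim (Fx i + Fy j) = min r (dim (Fx i) + dim (Fy j))` for all `1 ≤ i, j ≤ r+1`. -/
def IsGenericPair (k : Type*) [Field k] (V : Type*) [AddCommGroup V] [Module k V]
    (r : ℕ) (Fx Fy : ℕ → Submodule k V) : Prop :=
  IsFullFlag k V r Fx ∧ IsFullFlag k V r Fy ∧
  ∀ i j, 1 ≤ i → i ≤ r + 1 → 1 ≤ j → j ≤ r + 1 →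
    Module.finrank k ↥(Fx i ⊔ Fy j) =
      min r (Module.finrank k (Fx i) + Module.finrank k (Fy j))

/-- A generic triple: a generic pair of full flags together with a line `l` with
`dim (l + Fx i + Fy j) = min (1 + dim (Fx i) + dim (Fy j)) r` for all `1 ≤ i, j ≤ r+1`. -/
def IsGenericTriple (k : Type*) [Field k] (V : Type*) [AddCommGroup V] [Module k V]
    (r : ℕ) (Fx Fy : ℕ → Submodule k V) (l : Submodule k V) : Prop :=
  IsGenericPair k V r Fx Fy ∧ Module.finrank k l = 1 ∧
  ∀ i j, 1 ≤ i → i ≤ r + 1 → 1 ≤ j → j ≤ r + 1 →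
    Module.finrank k ↥(l ⊔ Fx i ⊔ Fy j) =
      min (1 + Module.finrank k (Fx i) + Module.finrank k (Fy j)) r

/-- `deg_V(W) = Σ_{i=2}^{r} dim (W ∩ Fx i) + Σ_{i=2}^{r} dim (W ∩ Fy i)`. -/
noncomputable def degV (k : Type*) [Field k] (V : Type*) [AddCommGroup V] [Module k V]
    (r : ℕ) (Fx Fy : ℕ → Submodule k V) (W : Submodule k V) : ℕ :=
  ∑ i ∈ Finset.Icc 2 r, Module.finrank k ↥(W ⊓ Fx i) +
    ∑ i ∈ Finset.Icc 2 r, Module.finrank k ↥(W ⊓ Fy i)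

/-- `deg(W) = deg_V(W) + (r-1)·dim (l ∩ W)`. -/
noncomputable def deg (k : Type*) [Field k] (V : Type*) [AddCommGroup V] [Module k V]
    (r : ℕ) (Fx Fy : ℕ → Submodule k V) (l : Submodule k V) (W : Submodule k V) : ℕ :=
  degV k V r Fx Fy W + (r - 1) * Module.finrank k ↥(l ⊓ W)

/-- If the sum of `A` and `B` is direct, the intersections of `W` with `A` and `B` are independent
inside `W ⊓ (A ⊔ B)`. -/
theorem finrank_inf_add_finrank_inf_le {k V : Type*} [Field k] [AddCommGroup V] [Module k V]
    [FiniteDimensional k V] {A B : Submodule k V} (W : Submodule k V)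
    (h : Module.finrank k ↥(A ⊔ B) = Module.finrank k A + Module.finrank k B) :
    Module.finrank k ↥(W ⊓ A) + Module.finrank k ↥(W ⊓ B) ≤
      Module.finrank k ↥(W ⊓ (A ⊔ B)) := by
  have hAB := Submodule.finrank_sup_add_finrank_inf_eq A B
  have hWAB := Submodule.finrank_sup_add_finrank_inf_eq (W ⊓ A) (W ⊓ B)
  have hinf : Module.finrank k ↥(W ⊓ A ⊓ (W ⊓ B)) ≤ Module.finrank k ↥(A ⊓ B) :=
    Submodule.finrank_mono (inf_le_inf inf_le_right inf_le_right)
  have hsup : Module.finrank k ↥(W ⊓ A ⊔ W ⊓ B) ≤ Module.finrank k ↥(W ⊓ (A ⊔ B)) :=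
    Submodule.finrank_mono le_inf_sup
  omega

/-- Reversing the order of summation over the interval `[2, n]`. -/
theorem sum_Icc_two_reflect (n : ℕ) (g : ℕ → ℕ) :
    ∑ i ∈ Finset.Icc 2 n, g (n + 2 - i) = ∑ i ∈ Finset.Icc 2 n, g i := by
  refine Finset.sum_nbij' (fun i => n + 2 - i) (fun i => n + 2 - i) ?_ ?_ ?_ ?_ ?_ <;>
    intro i hi <;> simp only [Finset.mem_Icc] at hi ⊢ <;> omega

section GenericTriple

variable {k V : Type*} [Field k] [AddCommGroup V] [Module k V] [FiniteDimensional k V]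
  {r : ℕ} {Fx Fy : ℕ → Submodule k V}

theorem IsGenericPair.degV_le (h : IsGenericPair k V r Fx Fy) (W : Submodule k V) :
    degV k V r Fx Fy W ≤ (r - 1) * Module.finrank k W := by
  obtain ⟨⟨-, hx⟩, ⟨-, hy⟩, hxy⟩ := h
  have key : ∀ i ∈ Finset.Icc 2 r, Module.finrank k ↥(W ⊓ Fx i) +
      Module.finrank k ↥(W ⊓ Fy (r + 2 - i)) ≤ Module.finrank k W := by
    intro i hi
    rw [Finset.mem_Icc] at hi
    have hxi := hx i (by omega) (by omega)
    have hyi := hy (r + 2 - i) (by omega) (by omega)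
    have hsup := hxy i (r + 2 - i) (by omega) (by omega) (by omega) (by omega)
    exact (finrank_inf_add_finrank_inf_le W (by omega)).trans
      (Submodule.finrank_mono inf_le_left)
  have hsum := Finset.sum_le_card_nsmul _ _ _ key
  rw [Finset.sum_add_distrib, sum_Icc_two_reflect r fun i => Module.finrank k ↥(W ⊓ Fy i),
    Nat.card_Icc, smul_eq_mul] at hsum
  exact hsum

theorem IsGenericTriple.degV_add_le {l : Submodule k V} (hr : 1 ≤ r)
    (h : IsGenericTriple k V r Fx Fy l) (W : Submodule k V) :
    degV k V r Fx Fy W + r * Module.finrank k ↥(l ⊓ W) ≤ r * Module.finrank k W := by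
  obtain ⟨⟨⟨-, hx⟩, ⟨-, hy⟩, hxy⟩, hl, hlxy⟩ := h
  have key : ∀ i ∈ Finset.Icc 2 (r + 1), Module.finrank k ↥(W ⊓ Fx i) +
      Module.finrank k ↥(W ⊓ Fy (r + 1 + 2 - i)) + Module.finrank k ↥(l ⊓ W) ≤
        Module.finrank k W := by
    intro i hi
    rw [Finset.mem_Icc] at hi
    have hxi := hx i (by omega) (by omega)
    have hyi := hy (r + 1 + 2 - i) (by omega) (by omega)
    have hsup := hxy i (r + 1 + 2 - i) (by omega) (by omega) (by omega) (by omega)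
    have hlsup := hlxy i (r + 1 + 2 - i) (by omega) (by omega) (by omega) (by omega)
    rw [sup_assoc] at hlsup
    have hpair := finrank_inf_add_finrank_inf_le (A := Fx i) (B := Fy (r + 1 + 2 - i)) W
      (by omega)
    have htriple := finrank_inf_add_finrank_inf_le (A := l) (B := Fx i ⊔ Fy (r + 1 + 2 - i)) W
      (by omega)
    have hle := Submodule.finrank_mono (R := k)
      (inf_le_left : W ⊓ (l ⊔ (Fx i ⊔ Fy (r + 1 + 2 - i))) ≤ W)
    rw [inf_comm l W]
    omega
  have hlast : ∀ F : ℕ → Submodule k V, Module.finrank k (F (r + 1)) = r + 1 - (r + 1) →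
      ∑ i ∈ Finset.Icc 2 (r + 1), Module.finrank k ↥(W ⊓ F i) =
        ∑ i ∈ Finset.Icc 2 r, Module.finrank k ↥(W ⊓ F i) := by
    intro F hF
    have hle := Submodule.finrank_mono (R := k) (inf_le_right : W ⊓ F (r + 1) ≤ F (r + 1))
    rw [Finset.sum_Icc_succ_top (by omega)]
    omega
  have hsum := Finset.sum_le_card_nsmul _ _ _ key
  rw [Finset.sum_add_distrib, Finset.sum_add_distrib,
    sum_Icc_two_reflect (r + 1) fun i => Module.finrank k ↥(W ⊓ Fy i),
    hlast Fx (hx _ (by omega) le_rfl), hlast Fy (hy _ (by omega) le_rfl), Finset.sum_const,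
    Nat.card_Icc, smul_eq_mul, smul_eq_mul] at hsum
  exact hsum

theorem IsGenericTriple.deg_lt {l : Submodule k V} (hr : 1 ≤ r)
    (h : IsGenericTriple k V r Fx Fy l) {W : Submodule k V} (hW : 0 < Module.finrank k W) :
    deg k V r Fx Fy l W < r * Module.finrank k W := by
  have hle := Submodule.finrank_mono (R := k) (inf_le_left : l ⊓ W ≤ l)
  rw [h.2.1] at hle
  unfold deg
  rcases Nat.le_one_iff_eq_zero_or_eq_one.mp hle with h0 | h1
  · have hpair := h.1.degV_le W
    have hlt : (r - 1) * Module.finrank k W < r * Module.finrank k W :=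
      Nat.mul_lt_mul_of_pos_right (by omega) hW
    rw [h0]
    omega
  · have htriple := h.degV_add_le hr W
    rw [h1] at htriple ⊢
    omega

end GenericTriple

/-- Proposition 7.3: for a generic triple in an `r`-dimensional space (`r ≥ 2`) and
every proper nonzero subspace `W`, one has `μ(W) < μ(V) = r - 1/r`. -/
theorem slope_lt_slope_top
    (k : Type*) [Field k] (V : Type*) [AddCommGroup V] [Module k V]
    [FiniteDimensional k V] (r : ℕ) (hr : 2 ≤ r) (hV : Module.finrank k V = r)
    (Fx Fy : ℕ → Submodule k V) (l : Submodule k V)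
    (h : IsGenericTriple k V r Fx Fy l)
    (W : Submodule k V) (hW0 : 0 < Module.finrank k W)
    (hWr : Module.finrank k W < r) :
    (deg k V r Fx Fy l W : ℚ) / (Module.finrank k W : ℚ) <
      (r : ℚ) - 1 / (r : ℚ) := by
  have hdeg : (deg k V r Fx Fy l W : ℚ) + 1 ≤ r * Module.finrank k W := by
    exact_mod_cast h.deg_lt (by omega) hW0
  have hd : (0 : ℚ) < Module.finrank k W := by exact_mod_cast hW0
  have hdr : (Module.finrank k W : ℚ) < r := by exact_mod_cast hWr
  have hr0 : (0 : ℚ) < r := hd.trans hdr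
  have hlt : (Module.finrank k W : ℚ) / r < 1 := (div_lt_one hr0).mpr hdr
  rw [div_lt_iff₀ hd, sub_mul, one_div_mul_eq_div]
  linarith
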